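/- arXiv:2407.07435 — 3 statements merged into one kernel-verified Lean document; each statement's English description precedes it below -/
import Mathlib

section
/- For every integer n ≥ 2, the space of sl_2-invariant 2-cocycles of the Heisenberg ideal h_n of the n-th Schrödinger algebra with values in the trivial module ℂ has dimension n(n+1)/2; concretely, an alternating bilinear map φ: h_n×h_n→ℂ is an sl_2-invariant 2-cocycle if and only if φ(x_i,z)=φ(y_i,z)=φ(x_i,x_j)=φ(y_i,y_j)=0 for all i,j and φ(x_i,y_j)=φ(x_j,y_i) for all i≠j. -/
open scoped BigOperators

/-- Basis index set for the `n`-th Schrödinger algebra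
`sch_n = span {h, e, f, x_1, …, x_n, y_1, …, y_n, z}`. -/
inductive SchIdx (n : ℕ) : Type
  | H : SchIdx n
  | E : SchIdx n
  | F : SchIdx n
  | X : Fin n → SchIdx n
  | Y : Fin n → SchIdx n
  | Z : SchIdx n
  deriving DecidableEq

/-- The underlying vector space of the `n`-th Schrödinger algebra. -/
abbrev Sch (n : ℕ) : Type := SchIdx n → ℂ

/-- The Lie bracket of `sch_n`, written componentwise with respect to the basis;
it encodes exactly the relations `[e,f]=h, [h,e]=2e, [h,f]=-2f, [x_i,y_i]=z,
[h,x_i]=x_i, [h,y_i]=-y_i, [e,y_i]=x_i, [f,x_i]=y_i`. -/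
noncomputable def br {n : ℕ} (u v : Sch n) : Sch n := fun j =>
  match j with
  | .H => u .E * v .F - u .F * v .E
  | .E => 2 * (u .H * v .E - u .E * v .H)
  | .F => -2 * (u .H * v .F - u .F * v .H)
  | .X i => (u .H * v (.X i) - u (.X i) * v .H) + (u .E * v (.Y i) - u (.Y i) * v .E)
  | .Y i => -(u .H * v (.Y i) - u (.Y i) * v .H) + (u .F * v (.X i) - u (.X i) * v .F)
  | .Z => ∑ i : Fin n, (u (.X i) * v (.Y i) - u (.Y i) * v (.X i))

/-- The bracket of `sch_n` as a bilinear map. -/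
noncomputable def brL (n : ℕ) : Sch n →ₗ[ℂ] Sch n →ₗ[ℂ] Sch n :=
  LinearMap.mk₂ ℂ br
    (by
      intro m m' v; funext j; cases j <;> simp only [br, Pi.add_apply]
      case Z => rw [← Finset.sum_add_distrib]; exact Finset.sum_congr rfl fun i _ => by ring
      all_goals ring)
    (by
      intro c m v; funext j; cases j <;> simp only [br, Pi.smul_apply, smul_eq_mul]
      case Z => rw [Finset.mul_sum]; exact Finset.sum_congr rfl fun i _ => by ring
      all_goals ring)
    (by
      intro m v v'; funext j; cases j <;> simp only [br, Pi.add_apply]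
      case Z => rw [← Finset.sum_add_distrib]; exact Finset.sum_congr rfl fun i _ => by ring
      all_goals ring)
    (by
      intro c m v; funext j; cases j <;> simp only [br, Pi.smul_apply, smul_eq_mul]
      case Z => rw [Finset.mul_sum]; exact Finset.sum_congr rfl fun i _ => by ring
      all_goals ring)

/-- The basis vector `h`. -/
noncomputable def hV (n : ℕ) : Sch n := Pi.single SchIdx.H 1
/-- The basis vector `e`. -/
noncomputable def eV (n : ℕ) : Sch n := Pi.single SchIdx.E 1
/-- The basis vector `f`. -/
noncomputable def fV (n : ℕ) : Sch n := Pi.single SchIdx.F 1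
/-- The central basis vector `z`. -/
noncomputable def zV (n : ℕ) : Sch n := Pi.single SchIdx.Z 1
/-- The basis vector `x_i`. -/
noncomputable def xV {n : ℕ} (i : Fin n) : Sch n := Pi.single (SchIdx.X i) 1
/-- The basis vector `y_i`. -/
noncomputable def yV {n : ℕ} (i : Fin n) : Sch n := Pi.single (SchIdx.Y i) 1

/-- The subalgebra `sl_2 = span {e, f, h}` of `sch_n`. -/
noncomputable def sl2 (n : ℕ) : Submodule ℂ (Sch n) :=
  Submodule.span ℂ {eV n, fV n, hV n}
/-- Basis index set for the Heisenberg ideal `h_n = span {x_1, …, x_n, y_1, …, y_n, z}`. -/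
inductive HIdx (n : ℕ) : Type
  | X : Fin n → HIdx n
  | Y : Fin n → HIdx n
  | Z : HIdx n
  deriving DecidableEq

/-- The underlying vector space of the Heisenberg ideal `h_n` of `sch_n`. -/
abbrev Heis (n : ℕ) : Type := HIdx n → ℂ

/-- The natural inclusion `h_n → sch_n`. -/
noncomputable def ιH {n : ℕ} (a : Heis n) : Sch n := fun j =>
  match j with
  | .X i => a (.X i)
  | .Y i => a (.Y i)
  | .Z => a .Z
  | .H => 0
  | .E => 0
  | .F => 0

/-- The action of `v ∈ sch_n` on the ideal `h_n`: `act v a = [v, a]`, viewed inside `h_n`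
(the ideal `h_n` is stable under taking brackets with any element). -/
noncomputable def act {n : ℕ} (v : Sch n) (a : Heis n) : Heis n := fun j =>
  match j with
  | .X i => brL n v (ιH a) (SchIdx.X i)
  | .Y i => brL n v (ιH a) (SchIdx.Y i)
  | .Z => brL n v (ιH a) SchIdx.Z

/-- The bracket of the Heisenberg algebra `h_n`. -/
noncomputable def brH {n : ℕ} (a b : Heis n) : Heis n := act (ιH a) b

/-- The basis vector `x_i` of `h_n`. -/
noncomputable def xH {n : ℕ} (i : Fin n) : Heis n := Pi.single (HIdx.X i) 1
/-- The basis vector `y_i` of `h_n`. -/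
noncomputable def yH {n : ℕ} (i : Fin n) : Heis n := Pi.single (HIdx.Y i) 1
/-- The basis vector `z` of `h_n`. -/
noncomputable def zH (n : ℕ) : Heis n := Pi.single HIdx.Z 1
/-- The space of `sl_2`-invariant 2-cocycles of the Heisenberg ideal `h_n` with trivial
coefficients: alternating bilinear maps `φ : h_n × h_n → ℂ` with
`φ(a,[b,c]) + φ(b,[c,a]) + φ(c,[a,b]) = 0` and `φ([v,a],b) + φ(a,[v,b]) = 0`
for all `v ∈ sl_2`. -/
noncomputable def trivInvZ2Heis (n : ℕ) : Submodule ℂ (Heis n →ₗ[ℂ] Heis n →ₗ[ℂ] ℂ) where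
  carrier := {φ | (∀ a, φ a a = 0) ∧
    (∀ a b c, φ a (brH b c) + φ b (brH c a) + φ c (brH a b) = 0) ∧
    ∀ v ∈ sl2 n, ∀ a b, φ (act v a) b + φ a (act v b) = 0}
  add_mem' := by
    rintro φ ψ ⟨hφ1, hφ2, hφ3⟩ ⟨hψ1, hψ2, hψ3⟩
    refine ⟨fun a => ?_, fun a b c => ?_, fun v hv a b => ?_⟩
    · simp only [LinearMap.add_apply, hφ1 a, hψ1 a, add_zero]
    · simp only [LinearMap.add_apply]
      linear_combination hφ2 a b c + hψ2 a b c
    · simp only [LinearMap.add_apply]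
      linear_combination hφ3 v hv a b + hψ3 v hv a b
  zero_mem' := ⟨fun a => rfl, fun a b c => by simp, fun v hv a b => by simp⟩
  smul_mem' := by
    rintro c φ ⟨hφ1, hφ2, hφ3⟩
    refine ⟨fun a => ?_, fun a b c' => ?_, fun v hv a b => ?_⟩
    · simp only [LinearMap.smul_apply, hφ1 a, smul_zero]
    · simp only [LinearMap.smul_apply, smul_eq_mul]
      linear_combination c * hφ2 a b c'
    · simp only [LinearMap.smul_apply, smul_eq_mul]
      linear_combination c * hφ3 v hv a b

theorem heis_decomposition {n : ℕ} (a : Heis n) :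
    a = ∑ i, a (.X i) • xH i + ∑ i, a (.Y i) • yH i + a .Z • zH n := by
  funext j
  cases j <;> simp [xH, yH, zH, Pi.single_apply]

theorem apply_eq_zero_of_mem_sl2 {n : ℕ} {v : Sch n} (hv : v ∈ sl2 n) (i : Fin n) :
    v (.X i) = 0 ∧ v (.Y i) = 0 := by
  induction hv using Submodule.span_induction with
  | mem x hx => rcases hx with rfl | rfl | rfl <;> simp [eV, fV, hV]
  | zero => simp
  | add x y _ _ hx hy => simp [hx, hy]
  | smul c x _ hx => simp [hx]

theorem act_X {n : ℕ} {v : Sch n} (hv : v ∈ sl2 n) (a : Heis n) (i : Fin n) :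
    act v a (.X i) = v .H * a (.X i) + v .E * a (.Y i) := by
  simp [act, brL, br, ιH, apply_eq_zero_of_mem_sl2 hv i]

theorem act_Y {n : ℕ} {v : Sch n} (hv : v ∈ sl2 n) (a : Heis n) (i : Fin n) :
    act v a (.Y i) = -(v .H * a (.Y i)) + v .F * a (.X i) := by
  simp [act, brL, br, ιH, apply_eq_zero_of_mem_sl2 hv i]

theorem act_Z {n : ℕ} {v : Sch n} (hv : v ∈ sl2 n) (a : Heis n) : act v a .Z = 0 := by
  simp [act, brL, br, ιH, fun i => apply_eq_zero_of_mem_sl2 hv i]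

theorem hV_mem_sl2 (n : ℕ) : hV n ∈ sl2 n := Submodule.subset_span (by simp)

theorem eV_mem_sl2 (n : ℕ) : eV n ∈ sl2 n := Submodule.subset_span (by simp)

theorem act_hV_xH {n : ℕ} (i : Fin n) : act (hV n) (xH i) = xH i := by
  funext j
  cases j <;> simp only [act_X (hV_mem_sl2 n), act_Y (hV_mem_sl2 n), act_Z (hV_mem_sl2 n)] <;>
    simp [hV, xH]

theorem act_hV_yH {n : ℕ} (i : Fin n) : act (hV n) (yH i) = -yH i := by
  funext j
  cases j <;> simp only [act_X (hV_mem_sl2 n), act_Y (hV_mem_sl2 n), act_Z (hV_mem_sl2 n)] <;>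
    simp [hV, yH]

theorem act_hV_zH (n : ℕ) : act (hV n) (zH n) = 0 := by
  funext j
  cases j <;> simp only [act_X (hV_mem_sl2 n), act_Y (hV_mem_sl2 n), act_Z (hV_mem_sl2 n)] <;>
    simp [hV, zH]

theorem act_eV_yH {n : ℕ} (i : Fin n) : act (eV n) (yH i) = xH i := by
  funext j
  cases j <;>
    simp only [act_X (eV_mem_sl2 n), act_Y (eV_mem_sl2 n), act_Z (eV_mem_sl2 n)] <;>
    simp [eV, xH, yH, Pi.single_apply]

theorem brH_eq {n : ℕ} (a b : Heis n) :
    brH a b = (∑ i, (a (.X i) * b (.Y i) - a (.Y i) * b (.X i))) • zH n := by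
  funext j
  cases j <;> simp [brH, act, brL, br, ιH, zH]

/-- The bilinear form on `h_n` determined by a symmetric matrix of values on the pairs
`(x_i, y_j)`. -/
noncomputable def symmForm (n : ℕ) :
    (Sym2 (Fin n) → ℂ) →ₗ[ℂ] Heis n →ₗ[ℂ] Heis n →ₗ[ℂ] ℂ where
  toFun w := LinearMap.mk₂ ℂ
    (fun a b => ∑ i, ∑ j, w s(i, j) * (a (.X i) * b (.Y j) - a (.Y j) * b (.X i)))
    (fun a a' b => by
      simp only [← Finset.sum_add_distrib, Pi.add_apply]
      exact Finset.sum_congr rfl fun i _ => Finset.sum_congr rfl fun j _ => by ring)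
    (fun c a b => by
      simp only [Pi.smul_apply, smul_eq_mul, Finset.mul_sum]
      exact Finset.sum_congr rfl fun i _ => Finset.sum_congr rfl fun j _ => by ring)
    (fun a b b' => by
      simp only [← Finset.sum_add_distrib, Pi.add_apply]
      exact Finset.sum_congr rfl fun i _ => Finset.sum_congr rfl fun j _ => by ring)
    (fun c a b => by
      simp only [Pi.smul_apply, smul_eq_mul, Finset.mul_sum]
      exact Finset.sum_congr rfl fun i _ => Finset.sum_congr rfl fun j _ => by ring)
  map_add' w w' := by
    refine LinearMap.ext₂ fun a b => ?_
    simp only [LinearMap.mk₂_apply, LinearMap.add_apply, Pi.add_apply, add_mul,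
      Finset.sum_add_distrib]
  map_smul' c w := by
    refine LinearMap.ext₂ fun a b => ?_
    simp only [LinearMap.mk₂_apply, LinearMap.smul_apply, Pi.smul_apply, smul_eq_mul,
      Finset.mul_sum, mul_assoc, RingHom.id_apply]

theorem symmForm_apply {n : ℕ} (w : Sym2 (Fin n) → ℂ) (a b : Heis n) :
    symmForm n w a b =
      ∑ i, ∑ j, w s(i, j) * (a (.X i) * b (.Y j) - a (.Y j) * b (.X i)) := rfl

theorem symmForm_xH_yH {n : ℕ} (w : Sym2 (Fin n) → ℂ) (i j : Fin n) :
    symmForm n w (xH i) (yH j) = w s(i, j) := by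
  simp [symmForm_apply, xH, yH, Pi.single_apply]

theorem sum_symm_mul_eq_zero {n : ℕ} (w : Sym2 (Fin n) → ℂ) (g : Fin n → Fin n → ℂ)
    (hg : ∀ i j, g i j = -g j i) : ∑ i, ∑ j, w s(i, j) * g i j = 0 := by
  refine self_eq_neg.mp ?_
  conv_lhs => rw [Finset.sum_comm]
  simp only [← Finset.sum_neg_distrib]
  refine Finset.sum_congr rfl fun i _ => Finset.sum_congr rfl fun j _ => ?_
  rw [Sym2.eq_swap, hg j i, mul_neg]

theorem symmForm_mem {n : ℕ} (w : Sym2 (Fin n) → ℂ) : symmForm n w ∈ trivInvZ2Heis n := by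
  have hz : ∀ a, symmForm n w a (zH n) = 0 := fun a => by simp [symmForm_apply, zH]
  refine ⟨fun a => ?_, fun a b c => ?_, fun v hv a b => ?_⟩
  · rw [symmForm_apply]
    simp only [mul_comm (a (.Y _)), sub_self, mul_zero, Finset.sum_const_zero]
  · simp only [brH_eq, map_smul, hz, smul_zero, add_zero]
  · rw [symmForm_apply, symmForm_apply, ← Finset.sum_add_distrib]
    simp only [← Finset.sum_add_distrib, ← mul_add, act_X hv, act_Y hv]
    exact sum_symm_mul_eq_zero w _ fun i j => by ring

theorem eq_symmForm {n : ℕ} {φ : Heis n →ₗ[ℂ] Heis n →ₗ[ℂ] ℂ} (halt : ∀ a, φ a a = 0)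
    (hxz : ∀ i, φ (xH i) (zH n) = 0) (hyz : ∀ i, φ (yH i) (zH n) = 0)
    (hxx : ∀ i j, φ (xH i) (xH j) = 0) (hyy : ∀ i j, φ (yH i) (yH j) = 0)
    (hxy : ∀ i j, i ≠ j → φ (xH i) (yH j) = φ (xH j) (yH i)) :
    ∃ w, symmForm n w = φ := by
  have hsymm : ∀ i j, φ (xH i) (yH j) = φ (xH j) (yH i) := fun i j => by
    rcases eq_or_ne i j with rfl | hij
    exacts [rfl, hxy i j hij]
  have hneg : ∀ a b, φ a b = -φ b a := fun a b => (LinearMap.IsAlt.neg halt b a).symm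
  have hzx : ∀ i, φ (zH n) (xH i) = 0 := fun i => by rw [hneg, hxz, neg_zero]
  have hzy : ∀ i, φ (zH n) (yH i) = 0 := fun i => by rw [hneg, hyz, neg_zero]
  refine ⟨Sym2.lift ⟨fun i j => φ (xH i) (yH j), hsymm⟩, LinearMap.ext₂ fun a b => ?_⟩
  rw [symmForm_apply]
  conv_rhs => rw [heis_decomposition a, heis_decomposition b]
  simp only [map_add, map_sum, map_smul, LinearMap.add_apply, LinearMap.sum_apply,
    LinearMap.smul_apply, hxz, hyz, hxx, hyy, hzx, hzy, halt, smul_eq_mul, mul_zero,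
    Finset.sum_const_zero, add_zero, zero_add, Sym2.lift_mk,
    sub_eq_add_neg, hneg (yH _) (xH _), Finset.mul_sum, mul_add,
    Finset.sum_add_distrib]
  rw [add_comm (∑ i, ∑ j, _ * (_ * -_))]
  congr 1
  · rw [Finset.sum_comm]
    exact Finset.sum_congr rfl fun i _ => Finset.sum_congr rfl fun j _ => by ring
  · exact Finset.sum_congr rfl fun i _ => Finset.sum_congr rfl fun j _ => by ring

theorem values_of_mem_trivInvZ2Heis {n : ℕ} {φ : Heis n →ₗ[ℂ] Heis n →ₗ[ℂ] ℂ}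
    (hφ : φ ∈ trivInvZ2Heis n) :
    (∀ i, φ (xH i) (zH n) = 0) ∧ (∀ i, φ (yH i) (zH n) = 0) ∧
      (∀ i j, φ (xH i) (xH j) = 0) ∧ (∀ i j, φ (yH i) (yH j) = 0) ∧
      (∀ i j, i ≠ j → φ (xH i) (yH j) = φ (xH j) (yH i)) := by
  obtain ⟨halt, -, hinv⟩ := hφ
  have hh := hinv _ (hV_mem_sl2 n)
  refine ⟨fun i => ?_, fun i => ?_, fun i j => ?_, fun i j => ?_, fun i j _ => ?_⟩
  · simpa [act_hV_xH, act_hV_zH] using hh (xH i) (zH n)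
  · simpa [act_hV_yH, act_hV_zH] using hh (yH i) (zH n)
  · have := hh (xH i) (xH j)
    rwa [act_hV_xH, act_hV_xH, add_self_eq_zero] at this
  · have := hh (yH i) (yH j)
    rwa [act_hV_yH, act_hV_yH, map_neg, map_neg, LinearMap.neg_apply, add_self_eq_zero,
      neg_eq_zero] at this
  · have := hinv _ (eV_mem_sl2 n) (yH i) (yH j)
    rw [act_eV_yH, act_eV_yH, ← LinearMap.IsAlt.neg halt (xH j) (yH i)] at this
    exact add_neg_eq_zero.mp this

theorem finrank_trivInvZ2Heis (n : ℕ) :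
    Module.finrank ℂ (trivInvZ2Heis n) = n * (n + 1) / 2 := by
  let f := (symmForm n).codRestrict (trivInvZ2Heis n) symmForm_mem
  have hf : Function.Bijective f := by
    refine ⟨fun w w' h => funext fun p => ?_, fun ⟨φ, hφ⟩ => ?_⟩
    · induction p using Sym2.ind with
      | _ i j =>
        rw [← symmForm_xH_yH w, ← symmForm_xH_yH w']
        exact congrArg (fun ψ : trivInvZ2Heis n => ψ.1 (xH i) (yH j)) h
    · obtain ⟨h₁, h₂, h₃, h₄, h₅⟩ := values_of_mem_trivInvZ2Heis hφ
      obtain ⟨w, hw⟩ := eq_symmForm hφ.1 h₁ h₂ h₃ h₄ h₅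
      exact ⟨w, Subtype.ext hw⟩
  rw [← (LinearEquiv.ofBijective f hf).finrank_eq, Module.finrank_fintype_fun_eq_card, Sym2.card,
    Fintype.card_fin, Nat.choose_two_right, Nat.add_sub_cancel, mul_comm]

/-- **For every `n ≥ 2`, the space of `sl_2`-invariant 2-cocycles of `h_n` with trivial
coefficients has dimension `n(n+1)/2`; concretely, an alternating bilinear map `φ` is an
`sl_2`-invariant 2-cocycle iff `φ(x_i,z) = φ(y_i,z) = φ(x_i,x_j) = φ(y_i,y_j) = 0` for
all `i, j` and `φ(x_i,y_j) = φ(x_j,y_i)` for all `i ≠ j`.** -/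
theorem trivInvZ2Heis_description (n : ℕ) (hn : 2 ≤ n) :
    Module.finrank ℂ ↥(trivInvZ2Heis n) = n * (n + 1) / 2 ∧
      ∀ φ : Heis n →ₗ[ℂ] Heis n →ₗ[ℂ] ℂ, (∀ a, φ a a = 0) →
        (φ ∈ trivInvZ2Heis n ↔
          (∀ i, φ (xH i) (zH n) = 0) ∧
          (∀ i, φ (yH i) (zH n) = 0) ∧
          (∀ i j, φ (xH i) (xH j) = 0) ∧
          (∀ i j, φ (yH i) (yH j) = 0) ∧
          (∀ i j, i ≠ j → φ (xH i) (yH j) = φ (xH j) (yH i))) := by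
  refine ⟨finrank_trivInvZ2Heis n, fun φ halt => ⟨values_of_mem_trivInvZ2Heis, ?_⟩⟩
  rintro ⟨hxz, hyz, hxx, hyy, hxy⟩
  obtain ⟨w, rfl⟩ := eq_symmForm halt hxz hyz hxx hyy hxy
  exact symmForm_mem w
end

section
/- For every integer n ≥ 2, the space of sl_2-invariant linear maps ω: h_n → sch_n from the Heisenberg ideal h_n to the n-th Schrödinger algebra sch_n has the following description: ω is sl_2-invariant if and only if there exist scalars α_{i,j} (1≤i,j≤n) and γ with ω(x_i)=Σ_j α_{i,j} x_j, ω(y_i)=Σ_j α_{i,j} y_j and ω(z)=γ z; in particular this space has dimension n²+1. -/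
open scoped BigOperators

/-- The space of `sl_2`-invariant linear maps `ω : h_n → sch_n`, i.e. those with
`[v, ω(a)] = ω([v,a])` for all `v ∈ sl_2` and `a ∈ h_n`. -/
noncomputable def invHom (n : ℕ) : Submodule ℂ (Heis n →ₗ[ℂ] Sch n) where
  carrier := {ω | ∀ v ∈ sl2 n, ∀ a, brL n v (ω a) = ω (act v a)}
  add_mem' := by
    rintro ω σ hω hσ v hv a
    simp only [LinearMap.add_apply, map_add, hω v hv a, hσ v hv a]
  zero_mem' := by intro v hv a; simp
  smul_mem' := by
    rintro c ω hω v hv a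
    simp only [LinearMap.smul_apply, map_smul, hω v hv a]

/-- The basis index set of `h_n` as a disjoint sum. -/
def HIdx.equivSum (n : ℕ) : HIdx n ≃ Fin n ⊕ Fin n ⊕ Unit where
  toFun
    | .X i => .inl i
    | .Y i => .inr (.inl i)
    | .Z => .inr (.inr ())
  invFun
    | .inl i => .X i
    | .inr (.inl i) => .Y i
    | .inr (.inr ()) => .Z
  left_inv j := by cases j <;> rfl
  right_inv j := by rcases j with i | i | u <;> rfl

instance (n : ℕ) : Finite (HIdx n) := Finite.of_equiv _ (HIdx.equivSum n).symm

/-- The linear map `h_n → sch_n` with `x_i ↦ Σ_j α_{i,j} x_j`, `y_i ↦ Σ_j α_{i,j} y_j` and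
`z ↦ γ z`, depending linearly on the pair `(α, γ)`. -/
noncomputable def scalarHom (n : ℕ) :
    ((Fin n → Fin n → ℂ) × ℂ) →ₗ[ℂ] Heis n →ₗ[ℂ] Sch n :=
  LinearMap.mk₂ ℂ
    (fun p a j => match j with
      | .X j => ∑ i, p.1 i j * a (.X i)
      | .Y j => ∑ i, p.1 i j * a (.Y i)
      | .Z => p.2 * a .Z
      | .H => 0
      | .E => 0
      | .F => 0)
    (by intro p q a; funext j; cases j <;> simp [add_mul, Finset.sum_add_distrib])
    (by intro c p a; funext j; cases j <;> simp [mul_assoc, Finset.mul_sum])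
    (by intro p a b; funext j; cases j <;> simp [mul_add, Finset.sum_add_distrib])
    (by intro c p a; funext j; cases j <;> simp [mul_left_comm, Finset.mul_sum])

section scalarHom

variable {n : ℕ} (p : (Fin n → Fin n → ℂ) × ℂ) (a : Heis n)

@[simp] lemma scalarHom_apply_X (j : Fin n) :
    scalarHom n p a (.X j) = ∑ i, p.1 i j * a (.X i) := rfl

@[simp] lemma scalarHom_apply_Y (j : Fin n) :
    scalarHom n p a (.Y j) = ∑ i, p.1 i j * a (.Y i) := rfl

@[simp] lemma scalarHom_apply_Z : scalarHom n p a .Z = p.2 * a .Z := rfl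

@[simp] lemma scalarHom_apply_H : scalarHom n p a .H = 0 := rfl

@[simp] lemma scalarHom_apply_E : scalarHom n p a .E = 0 := rfl

@[simp] lemma scalarHom_apply_F : scalarHom n p a .F = 0 := rfl

lemma scalarHom_xH (i : Fin n) : scalarHom n p (xH i) = ∑ j, p.1 i j • xV j := by
  funext j
  cases j <;> simp [xH, xV, Pi.single_apply, Finset.sum_apply]

lemma scalarHom_yH (i : Fin n) : scalarHom n p (yH i) = ∑ j, p.1 i j • yV j := by
  funext j
  cases j <;> simp [yH, yV, Pi.single_apply, Finset.sum_apply]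

lemma scalarHom_zH : scalarHom n p (zH n) = p.2 • zV n := by
  funext j
  cases j <;> simp [zH, zV]

end scalarHom

/-- A linear map out of `h_n` is determined by its values on the `x_i`, the `y_i` and `z`. -/
lemma heis_hom_ext {n : ℕ} {M : Type*} [AddCommMonoid M] [Module ℂ M] {ω σ : Heis n →ₗ[ℂ] M}
    (hx : ∀ i, ω (xH i) = σ (xH i)) (hy : ∀ i, ω (yH i) = σ (yH i))
    (hz : ω (zH n) = σ (zH n)) : ω = σ := by
  refine LinearMap.pi_ext' fun j => LinearMap.ext_ring ?_
  cases j with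
  | X i => exact hx i
  | Y i => exact hy i
  | Z => exact hz

lemma scalarHom_injective (n : ℕ) : Function.Injective (scalarHom n) := by
  intro p q h
  refine Prod.ext (funext fun i => funext fun j => ?_) ?_
  · simpa [xH, Pi.single_apply] using congrFun (LinearMap.congr_fun h (xH i)) (.X j)
  · simpa [zH] using congrFun (LinearMap.congr_fun h (zH n)) .Z

lemma sl2_apply_XYZ {n : ℕ} {v : Sch n} (hv : v ∈ sl2 n) :
    (∀ i, v (.X i) = 0) ∧ (∀ i, v (.Y i) = 0) ∧ v .Z = 0 := by
  induction hv using Submodule.span_induction with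
  | mem v hv =>
    rcases hv with rfl | rfl | rfl <;> simp [eV, fV, hV]
  | zero => simp
  | add u v _ _ hu hv => simp [hu, hv]
  | smul c v _ hv => simp [hv]

lemma brL_apply {n : ℕ} (u v : Sch n) : brL n u v = br u v := rfl

lemma scalarHom_mem_invHom {n : ℕ} (p : (Fin n → Fin n → ℂ) × ℂ) :
    scalarHom n p ∈ invHom n := by
  intro v hv a
  obtain ⟨hX, hY, -⟩ := sl2_apply_XYZ hv
  funext j
  cases j <;>
    simp [brL_apply, br, act, ιH, hX, hY, Finset.mul_sum, mul_add, Finset.sum_add_distrib,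
      mul_left_comm]

section invariant

variable {n : ℕ} {ω : Heis n →ₗ[ℂ] Sch n}

lemma br_h_xH (hω : ω ∈ invHom n) (i : Fin n) : br (hV n) (ω (xH i)) = ω (xH i) := by
  have h := hω (hV n) (Submodule.subset_span (by simp)) (xH i)
  have key : act (hV n) (xH i) = xH i := by
    funext j; cases j <;> simp [act, brL_apply, br, ιH, hV, xH, Pi.single_apply]
  rwa [key] at h

lemma br_f_xH (hω : ω ∈ invHom n) (i : Fin n) : br (fV n) (ω (xH i)) = ω (yH i) := by
  have h := hω (fV n) (Submodule.subset_span (by simp)) (xH i)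
  have key : act (fV n) (xH i) = yH i := by
    funext j; cases j <;> simp [act, brL_apply, br, ιH, fV, xH, yH, Pi.single_apply]
  rwa [key] at h

lemma br_zH (hω : ω ∈ invHom n) {v : Sch n} (hv : v ∈ sl2 n) : br v (ω (zH n)) = 0 := by
  have h := hω v hv (zH n)
  obtain ⟨hX, hY, -⟩ := sl2_apply_XYZ hv
  have key : act v (zH n) = 0 := by
    funext j; cases j <;> simp [act, brL_apply, br, ιH, zH, hX, hY]
  rwa [key, map_zero] at h

lemma mem_range_scalarHom (hω : ω ∈ invHom n) : ω ∈ LinearMap.range (scalarHom n) := by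
  have hx (i : Fin n) :
      ω (xH i) = ∑ j, ω (xH i) (.X j) • xV j := by
    have h (k) := congrFun (br_h_xH hω i) k
    funext k
    have hk := h k
    cases k <;> simp [br, hV, xV, Pi.single_apply, Finset.sum_apply] at hk ⊢ <;> grind
  have hy (i : Fin n) : ω (yH i) = ∑ j, ω (xH i) (.X j) • yV j := by
    rw [← br_f_xH hω i]
    conv_lhs => rw [hx i]
    funext k
    cases k <;> simp [br, fV, xV, yV, Pi.single_apply, Finset.sum_apply]
  have hz : ω (zH n) = ω (zH n) .Z • zV n := by
    have he (k) := congrFun (br_zH hω (v := eV n) (Submodule.subset_span (by simp))) k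
    have hf (k) := congrFun (br_zH hω (v := fV n) (Submodule.subset_span (by simp))) k
    funext k
    cases k with
    | H => simpa [br, eV, zV] using he .E
    | E => simpa [br, fV, zV] using hf .H
    | F => simpa [br, eV, zV] using he .H
    | X i => simpa [br, fV, zV] using hf (.Y i)
    | Y i => simpa [br, eV, zV] using he (.X i)
    | Z => simp [zV]
  refine ⟨(fun i j => ω (xH i) (.X j), ω (zH n) .Z), heis_hom_ext (fun i => ?_) (fun i => ?_) ?_⟩
  · rw [scalarHom_xH, ← hx]
  · rw [scalarHom_yH, ← hy]
  · rw [scalarHom_zH, ← hz]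

end invariant

lemma range_scalarHom (n : ℕ) : LinearMap.range (scalarHom n) = invHom n := by
  refine le_antisymm ?_ fun ω hω => mem_range_scalarHom hω
  rintro _ ⟨p, rfl⟩
  exact scalarHom_mem_invHom p

/-- **For every `n ≥ 2`, a linear map `ω : h_n → sch_n` is `sl_2`-invariant iff
`ω(x_i) = Σ_j α_{i,j} x_j`, `ω(y_i) = Σ_j α_{i,j} y_j` and `ω(z) = γ z` for some scalars
`α_{i,j}`, `γ`; in particular this space has dimension `n² + 1`.** -/
theorem invHom_description (n : ℕ) (hn : 2 ≤ n) :
    (∀ ω : Heis n →ₗ[ℂ] Sch n,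
      ω ∈ invHom n ↔
        ∃ (α : Fin n → Fin n → ℂ) (γ : ℂ),
          (∀ i, ω (xH i) = ∑ j : Fin n, α i j • xV j) ∧
          (∀ i, ω (yH i) = ∑ j : Fin n, α i j • yV j) ∧
          ω (zH n) = γ • zV n) ∧
    Module.finrank ℂ ↥(invHom n) = n ^ 2 + 1 := by
  refine ⟨fun ω => ?_, ?_⟩
  · rw [← range_scalarHom]
    constructor
    · rintro ⟨p, rfl⟩
      exact ⟨p.1, p.2, scalarHom_xH p, scalarHom_yH p, scalarHom_zH p⟩
    · rintro ⟨α, γ, hx, hy, hz⟩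
      refine ⟨(α, γ), heis_hom_ext (fun i => ?_) (fun i => ?_) ?_⟩
      · rw [scalarHom_xH, hx]
      · rw [scalarHom_yH, hy]
      · rw [scalarHom_zH, hz]
  · rw [← range_scalarHom, LinearMap.finrank_range_of_inj (scalarHom_injective n)]
    simp [Module.finrank_prod, Module.finrank_pi_fintype, sq]
end

section
/- For every integer n ≥ 3, the second adjoint cohomology of the n-th Schrödinger algebra vanishes: every alternating bilinear map φ: sch_n × sch_n → sch_n satisfying the 2-cocycle identity is a 2-coboundary, i.e. H²(sch_n, sch_n)=0. -/
open scoped BigOperators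

namespace Schrodinger

variable {n : ℕ}

/-- The standard basis vector of `Sch n` with index `s`. -/
noncomputable def bv (s : SchIdx n) : Sch n := Pi.single s 1

theorem bv_apply (s t : SchIdx n) : bv s t = if t = s then 1 else 0 := by
  simp [bv, Pi.single_apply]

instance : Finite (SchIdx n) :=
  Finite.of_injective
    (fun s : SchIdx n => (match s with
      | .H => .inl 0
      | .E => .inl 1
      | .F => .inl 2
      | .Z => .inl 3
      | .X i => .inr (.inl i)
      | .Y i => .inr (.inr i) : Fin 4 ⊕ Fin n ⊕ Fin n))
    (by rintro (_ | _ | _ | _ | _ | _) (_ | _ | _ | _ | _ | _) h <;> simp_all)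

theorem linearMap_ext_bv {M : Type*} [AddCommMonoid M] [Module ℂ M]
    {f g : Sch n →ₗ[ℂ] M} (h : ∀ s, f (bv s) = g (bv s)) : f = g :=
  LinearMap.pi_ext' fun s => LinearMap.ext_ring (h s)

/-- The linear endomorphism of `Sch n` with prescribed values on the standard basis. -/
noncomputable def ofValues (val : SchIdx n → Sch n) : Sch n →ₗ[ℂ] Sch n :=
  (Pi.basisFun ℂ (SchIdx n)).constr ℂ val

@[simp] theorem ofValues_bv (val : SchIdx n → Sch n) (s : SchIdx n) :
    ofValues val (bv s) = val s := by
  have := (Pi.basisFun ℂ (SchIdx n)).constr_basis ℂ val s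
  simpa [ofValues, bv] using this

section Components

variable (u v : Sch n) (i : Fin n)

theorem brL_H : brL n u v .H = u .E * v .F - u .F * v .E := rfl
theorem brL_E : brL n u v .E = 2 * (u .H * v .E - u .E * v .H) := rfl
theorem brL_F : brL n u v .F = -2 * (u .H * v .F - u .F * v .H) := rfl
theorem brL_X : brL n u v (.X i) =
    (u .H * v (.X i) - u (.X i) * v .H) + (u .E * v (.Y i) - u (.Y i) * v .E) := rfl
theorem brL_Y : brL n u v (.Y i) =
    -(u .H * v (.Y i) - u (.Y i) * v .H) + (u .F * v (.X i) - u (.X i) * v .F) := rfl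
theorem brL_Z : brL n u v .Z = ∑ i : Fin n, (u (.X i) * v (.Y i) - u (.Y i) * v (.X i)) := rfl

end Components

theorem brL_self (a : Sch n) : brL n a a = 0 := by
  funext j
  cases j <;> simp only [brL_H, brL_E, brL_F, brL_X, brL_Y, brL_Z, Pi.zero_apply]
  case Z => exact Finset.sum_eq_zero fun i _ => by ring
  all_goals ring

theorem brL_skew (a b : Sch n) : brL n a b = -brL n b a := by
  have h := brL_self (a + b)
  simp only [map_add, LinearMap.add_apply, brL_self, zero_add, add_zero] at h
  exact eq_neg_of_add_eq_zero_right h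

theorem jacobi (a b c : Sch n) :
    brL n a (brL n b c) + brL n b (brL n c a) + brL n c (brL n a b) = 0 := by
  funext j
  cases j <;> simp only [brL_H, brL_E, brL_F, brL_X, brL_Y, brL_Z, Pi.zero_apply, Pi.add_apply]
  case Z =>
    rw [← Finset.sum_add_distrib, ← Finset.sum_add_distrib]
    exact Finset.sum_eq_zero fun i _ => by ring
  all_goals ring

/-- Alternating bilinear maps satisfying the 2-cocycle identity. -/
def IsCocycle (φ : Sch n →ₗ[ℂ] Sch n →ₗ[ℂ] Sch n) : Prop :=
  (∀ a, φ a a = 0) ∧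
    ∀ a b c, brL n a (φ b c) + brL n b (φ c a) + brL n c (φ a b) +
        φ a (brL n b c) + φ b (brL n c a) + φ c (brL n a b) = 0

/-- The coboundary of a linear endomorphism. -/
noncomputable def coboundary (ω : Sch n →ₗ[ℂ] Sch n) : Sch n →ₗ[ℂ] Sch n →ₗ[ℂ] Sch n :=
  brL n ∘ₗ ω + (brL n).compl₂ ω - (brL n).compr₂ ω

theorem coboundary_apply (ω : Sch n →ₗ[ℂ] Sch n) (a b : Sch n) :
    coboundary ω a b = brL n (ω a) b + brL n a (ω b) - ω (brL n a b) := by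
  simp [coboundary]

theorem coboundary_add (ω ω' : Sch n →ₗ[ℂ] Sch n) :
    coboundary (ω + ω') = coboundary ω + coboundary ω' := by
  refine LinearMap.ext fun a => LinearMap.ext fun b => ?_
  simp only [coboundary_apply, LinearMap.add_apply, map_add]
  abel

theorem isCocycle_coboundary (ω : Sch n →ₗ[ℂ] Sch n) : IsCocycle (coboundary ω) := by
  refine ⟨fun a => ?_, fun a b c => ?_⟩
  · rw [coboundary_apply, brL_self, map_zero, brL_skew (ω a) a]
    abel
  · simp only [coboundary_apply, map_add, map_sub]
    have h := congrArg ω (jacobi a b c)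
    simp only [map_add, map_zero] at h
    linear_combination jacobi (ω a) b c + jacobi a (ω b) c + jacobi a b (ω c) - h

namespace IsCocycle

variable {φ ψ : Sch n →ₗ[ℂ] Sch n →ₗ[ℂ] Sch n}

theorem sub (hφ : IsCocycle φ) (hψ : IsCocycle ψ) : IsCocycle (φ - ψ) := by
  refine ⟨fun a => by simp [hφ.1, hψ.1], fun a b c => ?_⟩
  simp only [LinearMap.sub_apply, map_sub]
  linear_combination hφ.2 a b c - hψ.2 a b c

theorem skew (hφ : IsCocycle φ) (a b : Sch n) : φ a b = -φ b a := by
  have h := hφ.1 (a + b)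
  simp only [map_add, LinearMap.add_apply, hφ.1, zero_add, add_zero] at h
  exact eq_neg_of_add_eq_zero_right h

end IsCocycle

/-- The eigenvalue of `ad h` on a basis vector. -/
noncomputable def wt : SchIdx n → ℂ
  | .H => 0
  | .E => 2
  | .F => -2
  | .X _ => 1
  | .Y _ => -1
  | .Z => 0

theorem brL_bv_H_apply (v : Sch n) (c : SchIdx n) : brL n (bv .H) v c = wt c * v c := by
  cases c <;> simp [brL_H, brL_E, brL_F, brL_X, brL_Y, brL_Z, bv_apply, wt]

theorem brL_bv_H_bv (s : SchIdx n) : brL n (bv .H) (bv s) = wt s • bv s := by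
  funext c
  rw [brL_bv_H_apply, Pi.smul_apply, smul_eq_mul, bv_apply]
  split_ifs with h <;> simp [h]

/-- Every cocycle can be normalised so that contraction with `h` commutes with `ad h`. -/
theorem exists_contraction_commute {φ : Sch n →ₗ[ℂ] Sch n →ₗ[ℂ] Sch n} (hφ : IsCocycle φ) :
    ∃ ω : Sch n →ₗ[ℂ] Sch n, ∀ v,
      brL n (bv .H) ((φ - coboundary ω) (bv .H) v) =
        (φ - coboundary ω) (bv .H) (brL n (bv .H) v) := by
  refine ⟨ofValues fun s c => φ (bv .H) (bv s) c / (wt c - wt s), fun v => ?_⟩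
  set ω := ofValues fun s c => φ (bv .H) (bv s) c / (wt c - wt s) with hω
  have hωH : ω (bv .H) = 0 := by
    rw [hω, ofValues_bv]
    funext c
    simp [hφ.1]
  refine LinearMap.congr_fun (f := brL n (bv .H) ∘ₗ (φ - coboundary ω) (bv .H))
    (g := (φ - coboundary ω) (bv .H) ∘ₗ brL n (bv .H)) (linearMap_ext_bv fun s => ?_) v
  funext c
  simp only [LinearMap.comp_apply, brL_bv_H_bv, map_smul, LinearMap.sub_apply, coboundary_apply,
    hωH, map_zero, LinearMap.zero_apply, zero_add, Pi.sub_apply, Pi.smul_apply, smul_eq_mul,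
    brL_bv_H_apply]
  rw [hω, ofValues_bv]
  by_cases hc : wt c = wt s
  · simp [hc]
  · have : wt c - wt s ≠ 0 := sub_ne_zero.2 hc
    field_simp
    ring

/-- A cocycle whose contraction with `h` commutes with `ad h` has weight zero. -/
theorem IsCocycle.apply_eq_zero_of_wt {φ : Sch n →ₗ[ℂ] Sch n →ₗ[ℂ] Sch n} (hφ : IsCocycle φ)
    (hH : ∀ v, brL n (bv .H) (φ (bv .H) v) = φ (bv .H) (brL n (bv .H) v))
    (s t c : SchIdx n) (hc : wt c ≠ wt s + wt t) : φ (bv s) (bv t) c = 0 := by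
  have key : brL n (bv .H) (brL n (bv .H) (φ (bv s) (bv t))) =
      (2 * (wt s + wt t)) • brL n (bv .H) (φ (bv s) (bv t)) -
        ((wt s + wt t) ^ 2) • φ (bv s) (bv t) := by
    have hs := brL_bv_H_bv s
    have ht := brL_bv_H_bv t
    set h : Sch n := bv .H
    set a := bv s
    set b := bv t
    have e := hφ.2 h a b
    have hbh : brL n b h = -(wt t • b) := by rw [brL_skew, ht]
    have hphi : φ b h = -φ h b := hφ.skew b h
    rw [hs, hbh, hphi] at e
    simp only [map_neg, map_smul, smul_neg, hφ.skew b a] at e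
    have hDa : brL n h (φ h a) = wt s • φ h a := by rw [hH, hs, map_smul]
    have hDb : brL n h (φ h b) = wt t • φ h b := by rw [hH, ht, map_smul]
    have j₁ := jacobi h a (φ h b)
    have j₂ := jacobi h b (φ h a)
    have j₃ := jacobi h a b
    rw [hs, brL_skew (φ h b) h, hDb, brL_skew (φ h b)] at j₁
    rw [ht, brL_skew (φ h a) h, hDa, brL_skew (φ h a)] at j₂
    rw [hs, hbh, brL_skew b] at j₃
    simp only [map_neg, map_smul, LinearMap.smul_apply] at j₁ j₂ j₃
    have hD := congrArg (φ h) j₃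
    simp only [map_add, map_neg, map_smul, map_zero] at hD
    have e' := congrArg (brL n h) e
    simp only [map_add, map_neg, map_smul, map_zero, hH (brL n a b)] at e'
    linear_combination (norm := module) e' - (wt s + wt t) • e + j₁ - j₂ - hD
  have := congrFun key c
  simp only [brL_bv_H_apply, Pi.sub_apply, Pi.smul_apply, smul_eq_mul] at this
  have h2 : (wt c - (wt s + wt t)) ^ 2 * φ (bv s) (bv t) c = 0 := by
    linear_combination this
  exact (mul_eq_zero.1 h2).resolve_left (pow_ne_zero _ (sub_ne_zero.2 hc))

section BracketTable

variable (i j : Fin n)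

theorem brL_H_E : brL n (bv .H) (bv .E) = (2 : ℂ) • bv .E := brL_bv_H_bv _
theorem brL_H_F : brL n (bv .H) (bv .F) = (-2 : ℂ) • bv .F := brL_bv_H_bv _
theorem brL_H_X : brL n (bv .H) (bv (.X i)) = bv (.X i) := by simp [brL_bv_H_bv, wt]
theorem brL_H_Y : brL n (bv .H) (bv (.Y i)) = -bv (.Y i) := by simp [brL_bv_H_bv, wt]

theorem brL_E_F : brL n (bv .E) (bv .F) = bv .H := by
  funext c; cases c <;> simp [brL_H, brL_E, brL_F, brL_X, brL_Y, brL_Z, bv_apply]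

theorem brL_E_X : brL n (bv .E) (bv (.X i)) = 0 := by
  funext c; cases c <;> simp [brL_H, brL_E, brL_F, brL_X, brL_Y, brL_Z, bv_apply]

theorem brL_E_Y : brL n (bv .E) (bv (.Y i)) = bv (.X i) := by
  funext c; cases c <;> simp [brL_H, brL_E, brL_F, brL_X, brL_Y, brL_Z, bv_apply]

theorem brL_F_X : brL n (bv .F) (bv (.X i)) = bv (.Y i) := by
  funext c; cases c <;> simp [brL_H, brL_E, brL_F, brL_X, brL_Y, brL_Z, bv_apply]

theorem brL_F_Y : brL n (bv .F) (bv (.Y i)) = 0 := by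
  funext c; cases c <;> simp [brL_H, brL_E, brL_F, brL_X, brL_Y, brL_Z, bv_apply]

theorem brL_X_X : brL n (bv (.X i)) (bv (.X j)) = 0 := by
  funext c; cases c <;> simp [brL_H, brL_E, brL_F, brL_X, brL_Y, brL_Z, bv_apply]

theorem brL_Y_Y : brL n (bv (.Y i)) (bv (.Y j)) = 0 := by
  funext c; cases c <;> simp [brL_H, brL_E, brL_F, brL_X, brL_Y, brL_Z, bv_apply]

theorem brL_X_Y : brL n (bv (.X i)) (bv (.Y j)) = if i = j then bv .Z else 0 := by
  split_ifs with h <;> funext c <;> cases c <;>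
    simp [brL_H, brL_E, brL_F, brL_X, brL_Y, brL_Z, bv_apply, h, eq_comm (a := j)]

theorem brL_central_right (a : Sch n) : brL n a (bv .Z) = 0 := by
  funext c; cases c <;> simp [brL_H, brL_E, brL_F, brL_X, brL_Y, brL_Z, bv_apply]

theorem brL_central_left (a : Sch n) : brL n (bv .Z) a = 0 := by
  rw [brL_skew, brL_central_right, neg_zero]

end BracketTable

/-- Normalisation conditions on a cocycle that can be achieved by subtracting a coboundary. -/
structure IsNormalized (φ : Sch n →ₗ[ℂ] Sch n →ₗ[ℂ] Sch n) : Prop where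
  commute : ∀ v, brL n (bv .H) (φ (bv .H) v) = φ (bv .H) (brL n (bv .H) v)
  H_E : φ (bv .H) (bv .E) .E = 0
  E_F_H : φ (bv .E) (bv .F) .H = 0
  E_F_Z : φ (bv .E) (bv .F) .Z = 0
  E_Y : ∀ i j, φ (bv .E) (bv (.Y i)) (.X j) = 0
  E_Z : φ (bv .E) (bv .Z) .E = 0
  X_Y : ∀ i j, φ (bv (.X i)) (bv (.Y j)) .Z + φ (bv (.X j)) (bv (.Y i)) .Z = 0

theorem exists_isNormalized {φ : Sch n →ₗ[ℂ] Sch n →ₗ[ℂ] Sch n}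
    (hH : ∀ v, brL n (bv .H) (φ (bv .H) v) = φ (bv .H) (brL n (bv .H) v)) :
    ∃ ω : Sch n →ₗ[ℂ] Sch n, IsNormalized (φ - coboundary ω) := by
  let p := φ (bv .H) (bv .E) .E / 2
  let r := φ (bv .E) (bv .F) .H + p
  let M : Fin n → Fin n → ℂ := fun i j => φ (bv .E) (bv (.Y i)) (.X j) - if i = j then r else 0
  let P : Fin n → Fin n → ℂ := fun i j => (φ (bv (.X i)) (bv (.Y j)) .Z - M i j) / 2
  let val : SchIdx n → Sch n := fun s c => match s, c with
    | .H, .H => p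
    | .H, .Z => -φ (bv .E) (bv .F) .Z
    | .E, .E => r
    | .X i, .X j => P i j
    | .Y i, .Y j => P i j + M i j
    | .Z, .H => -φ (bv .E) (bv .Z) .E / 2
    | _, _ => 0
  have hval : ∀ s c, wt c * val s c = wt s * val s c := by
    intro s c
    cases s <;> cases c <;> simp [val, wt]
  have hω : ∀ v, brL n (bv .H) (ofValues val v) = ofValues val (brL n (bv .H) v) := by
    refine fun v => LinearMap.congr_fun (f := brL n (bv .H) ∘ₗ ofValues val)
      (g := ofValues val ∘ₗ brL n (bv .H)) (linearMap_ext_bv fun s => ?_) v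
    funext c
    simp only [LinearMap.comp_apply, brL_bv_H_bv, map_smul, ofValues_bv, brL_bv_H_apply,
      Pi.smul_apply, smul_eq_mul, hval]
  refine ⟨ofValues val, ⟨fun v => ?_, ?_, ?_, ?_, fun i j => ?_, ?_, fun i j => ?_⟩⟩
  · have hc : brL n (bv .H) (ofValues val (bv .H)) = 0 := by
      rw [hω, brL_self, map_zero]
    have e := jacobi (bv .H) (ofValues val (bv .H)) v
    rw [hc, map_zero, add_zero, brL_skew v (bv .H), map_neg] at e
    simp only [LinearMap.sub_apply, coboundary_apply, map_sub, map_add, hH, hω]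
    linear_combination -e
  · simp [coboundary_apply, brL_H_E, val, brL_E, bv_apply, p]
    ring
  · simp [coboundary_apply, brL_E_F, val, brL_H, bv_apply, r]
  · simp [coboundary_apply, brL_E_F, val, brL_Z, bv_apply]
  · simp [coboundary_apply, brL_E_Y, val, brL_X, bv_apply, M]
    split_ifs <;> simp_all
    ring
  · simp [coboundary_apply, brL_central_right, val, brL_E, bv_apply]
    ring
  · simp [coboundary_apply, brL_X_Y, val, brL_Z, bv_apply, P]
    split_ifs <;> simp_all [val] <;> ring

theorem IsNormalized.eq_zero (hn : 3 ≤ n) {φ : Sch n →ₗ[ℂ] Sch n →ₗ[ℂ] Sch n}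
    (hφ : IsCocycle φ) (h : IsNormalized φ) : φ = 0 := by
  have W := hφ.apply_eq_zero_of_wt h.commute
  have hEH := hφ.skew (bv .E) (bv .H)
  have hFH := hφ.skew (bv .F) (bv .H)
  have hFE := hφ.skew (bv .F) (bv .E)
  have hXH := fun i => hφ.skew (bv (.X i)) (bv .H)
  have hXE := fun i => hφ.skew (bv (.X i)) (bv .E)
  have hXF := fun i => hφ.skew (bv (.X i)) (bv .F)
  have hYH := fun i => hφ.skew (bv (.Y i)) (bv .H)
  have hYE := fun i => hφ.skew (bv (.Y i)) (bv .E)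
  have hYF := fun i => hφ.skew (bv (.Y i)) (bv .F)
  have hYX := fun i j => hφ.skew (bv (.Y i)) (bv (.X j))
  have hZ := hφ.skew (bv .Z)
  have h₁ := h.H_E
  have h₂ := h.E_F_H
  have h₃ := h.E_F_Z
  have h₄ := h.E_Y
  have h₅ := h.E_Z
  have HF : φ (bv .H) (bv .F) .F = 0 := by
    have e := congrFun (hφ.2 (bv .H) (bv .E) (bv .F)) .H
    simpa [brL_H_E, brL_E_F, brL_skew (bv .F) (bv .H), brL_H_F, brL_H, bv_apply, hφ.1, hFH, hFE,
      h₁, h₂, h₃] using e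
  have FX : ∀ i j, φ (bv .F) (bv (.X i)) (.Y j) = φ (bv .H) (bv (.X i)) (.X j) := by
    intro i j
    have e := congrFun (hφ.2 (bv .E) (bv .F) (bv (.X i))) (.X j)
    simp [brL_E_F, brL_skew (bv (.X i)) (bv .E), brL_E_X, brL_F_X, brL_X, bv_apply, hXE, hXH,
      h₂, h₄] at e
    linear_combination e
  have HY : ∀ i j, φ (bv .H) (bv (.Y i)) (.Y j) = -φ (bv .F) (bv (.X i)) (.Y j) := by
    intro i j
    have e := congrFun (hφ.2 (bv .E) (bv .F) (bv (.Y i))) (.Y j)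
    simp [brL_E_F, brL_skew (bv (.Y i)) (bv .E), brL_E_Y, brL_F_Y, brL_Y, bv_apply, hYE, hYH,
      h₂, h₄] at e
    linear_combination -e
  have HX : ∀ i j, φ (bv .H) (bv (.X i)) (.X j) = 0 := by
    intro i j
    have e := congrFun (hφ.2 (bv .H) (bv .E) (bv (.Y i))) (.X j)
    simp [brL_H_E, brL_skew (bv (.Y i)) (bv .H), brL_E_Y, brL_H_Y, brL_X, bv_apply, hYE, hYH,
      h₁, h₄, HY, FX] at e
    exact e
  simp only [HX] at FX
  simp only [FX, neg_zero] at HY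
  have HZH : φ (bv .H) (bv .Z) .H = 0 := by
    have e := congrFun (hφ.2 (bv .H) (bv .E) (bv .Z)) .E
    simpa [brL_H_E, brL_central_left, brL_central_right, brL_E, bv_apply, hZ, W, wt, h₁, h₅]
      using e
  have HZZ : φ (bv .H) (bv .Z) .Z = 0 := by
    have e := congrFun (hφ.2 (bv .E) (bv .F) (bv .Z)) .Z
    simpa [brL_E_F, brL_central_left, brL_central_right, brL_Z, bv_apply, hZ, W, wt] using e
  have FZ : φ (bv .F) (bv .Z) .F = 0 := by
    have e := congrFun (hφ.2 (bv .E) (bv .F) (bv .Z)) .H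
    simpa [brL_E_F, brL_central_left, brL_central_right, brL_H, bv_apply, hZ, W, wt, HZH, h₅] using e
  have XX : ∀ i j, φ (bv (.X i)) (bv (.X j)) .E = -2 * φ (bv (.X i)) (bv (.Y j)) .H := by
    intro i j
    have e := congrFun (hφ.2 (bv .E) (bv (.X i)) (bv (.Y j))) .E
    have hEz : φ (bv .E) (brL n (bv (.X i)) (bv (.Y j))) .E = 0 := by
      rw [brL_X_Y]
      split_ifs <;> simp [h₅]
    simp [hEz, brL_skew (bv (.Y j)) (bv .E), brL_E_X, brL_E_Y, brL_E, bv_apply] at e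
    linear_combination -e
  have YY : ∀ i j, φ (bv (.Y i)) (bv (.Y j)) .F =
      φ (bv (.X i)) (bv (.Y j)) .H - φ (bv (.X j)) (bv (.Y i)) .H := by
    intro i j
    have e := congrFun (hφ.2 (bv .E) (bv (.Y i)) (bv (.Y j))) .H
    simp [brL_skew (bv (.Y j)) (bv .E), brL_Y_Y, brL_E_Y, brL_H, bv_apply, hYX] at e
    linear_combination e
  have XYZ : ∀ i j, φ (bv (.X i)) (bv (.Y j)) .Z = 0 := by
    intro i j
    have e := congrFun (hφ.2 (bv .E) (bv (.Y i)) (bv (.Y j))) .Z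
    simp [brL_skew (bv (.Y j)) (bv .E), brL_Y_Y, brL_E_Y, brL_Z, bv_apply, hYX, hYE, h₄] at e
    linear_combination (h.X_Y i j - e) / 2
  have exists_ne : ∀ j k : Fin n, ∃ i, i ≠ j ∧ i ≠ k := by
    intro j k
    obtain ⟨i, hi⟩ := Finset.exists_mem_notMem_of_card_lt_card
      (s := {j, k}) (t := (Finset.univ : Finset (Fin n)))
      (by simpa using (Finset.card_le_two).trans_lt hn)
    exact ⟨i, by simpa [not_or] using hi⟩
  have XYH : ∀ j k, φ (bv (.X j)) (bv (.Y k)) .H = 0 := by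
    intro j k
    by_cases hjk : j = k
    · subst hjk
      have e := XX j j
      rw [hφ.1] at e
      simpa using e
    · obtain ⟨i, hij, hik⟩ := exists_ne j k
      have e := congrFun (hφ.2 (bv (.X i)) (bv (.X j)) (bv (.Y k))) (.X i)
      simpa [brL_X_X, brL_X_Y, brL_skew (bv (.Y k)) (bv (.X i)), brL_X, bv_apply, hij, hik, hjk,
        W, wt] using e
  simp only [XYH, mul_zero, sub_zero] at XX YY
  have XZ : ∀ i j, φ (bv (.X i)) (bv .Z) (.X j) = 0 := by
    intro i j
    obtain ⟨k, hk, -⟩ := exists_ne i i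
    have e := congrFun (hφ.2 (bv (.X i)) (bv (.X k)) (bv (.Y k))) (.X j)
    simpa [brL_X_X, brL_X_Y, brL_skew (bv (.Y k)) (bv (.X i)), brL_X, bv_apply, hk.symm, hYX,
      W, wt, XYH, XX] using e
  have YZ : ∀ i j, φ (bv (.Y i)) (bv .Z) (.Y j) = 0 := by
    intro i j
    have e := congrFun (hφ.2 (bv .E) (bv (.Y i)) (bv .Z)) (.X j)
    simpa [brL_E_Y, brL_central_left, brL_central_right, brL_X, bv_apply, hZ, hφ.1, W, wt, XZ,
      h₅] using e
  refine linearMap_ext_bv fun s => linearMap_ext_bv fun t => ?_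
  funext c
  by_cases hc : wt c = wt s + wt t
  · cases s <;> cases t <;> cases c <;> norm_num [wt] at hc <;>
      simp [hφ.1, hEH, hFH, hFE, hXH, hXF, hYH, hYE, hYX, hZ, h₁, h₂, h₃, h₄, h₅,
        HF, FX, HX, HY, HZH, HZZ, FZ, XX, YY, XYZ, XYH, XZ, YZ]
  · simpa using W s t c hc

end Schrodinger

/-- **For every `n ≥ 3`, the second adjoint cohomology of the `n`-th Schrödinger algebra
vanishes: every alternating bilinear 2-cocycle `φ : sch_n × sch_n → sch_n` is a
2-coboundary, i.e. `H²(sch_n, sch_n) = 0`.** -/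
theorem H2_adjoint_schrodinger_eq_zero (n : ℕ) (hn : 3 ≤ n) :
    ∀ φ : Sch n →ₗ[ℂ] Sch n →ₗ[ℂ] Sch n,
      (∀ a, φ a a = 0) →
      (∀ a b c, brL n a (φ b c) + brL n b (φ c a) + brL n c (φ a b) +
        φ a (brL n b c) + φ b (brL n c a) + φ c (brL n a b) = 0) →
      ∃ ω : Sch n →ₗ[ℂ] Sch n, ∀ a b,
        φ a b = brL n (ω a) b + brL n a (ω b) - ω (brL n a b) := by
  intro φ h₀ h₁
  have hφ : Schrodinger.IsCocycle φ := ⟨h₀, h₁⟩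
  obtain ⟨ω, hω⟩ := Schrodinger.exists_contraction_commute hφ
  obtain ⟨ω', hω'⟩ := Schrodinger.exists_isNormalized hω
  have h := hω'.eq_zero hn ((hφ.sub (Schrodinger.isCocycle_coboundary ω)).sub
    (Schrodinger.isCocycle_coboundary ω'))
  refine ⟨ω + ω', fun a b => ?_⟩
  rw [← Schrodinger.coboundary_apply, Schrodinger.coboundary_add]
  have hab := LinearMap.congr_fun₂ h a b
  simp only [LinearMap.sub_apply, LinearMap.zero_apply] at hab
  rw [LinearMap.add_apply, LinearMap.add_apply]
  linear_combination hab
end
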